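/- If the 1-form π is closed, i.e. (∇_Y π)(Z) = (∇_Z π)(Y) for all vector fields Y, Z (equivalently g(∇_Y P, Z) = g(∇_Z P, Y)), then the Ricci tensor of the semi-symmetric metric connection is symmetric: S̄(Y,Z) = S̄(Z,Y) for all vector fields Y, Z. -/

import Mathlib

open scoped BigOperators

/-! Setup: an open set `U ⊆ ℝⁿ` with a Riemannian metric given by component functions
`g x i j`, the Levi-Civita connection computed from the Christoffel symbols, the
semi-symmetric metric connection `∇̄_X Y = ∇_X Y + π(Y)X − g(X,Y)P`, curvature and
Ricci tensors of a connection, and covariant derivatives of `(0,2)`-tensors. -/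

/-- A vector field on (an open subset of) `ℝⁿ`. -/
abbrev VF (n : ℕ) := (Fin n → ℝ) → Fin n → ℝ

/-- Partial derivative `∂ᵢ f` of a real-valued function. -/
noncomputable def pd {n : ℕ} (i : Fin n) (f : (Fin n → ℝ) → ℝ) (x : Fin n → ℝ) : ℝ :=
  fderiv ℝ f x (Pi.single i 1)

/-- The metric evaluated on two tangent vectors at the point `x`. -/
def gval {n : ℕ} (g : (Fin n → ℝ) → Fin n → Fin n → ℝ) (x v w : Fin n → ℝ) : ℝ :=
  ∑ i, ∑ j, g x i j * v i * w j

/-- The Christoffel symbols `Γ^k_{ij} = ½ g^{kl}(∂ᵢ g_{jl} + ∂ⱼ g_{il} − ∂_l g_{ij})`. -/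
noncomputable def christoffel {n : ℕ} (g : (Fin n → ℝ) → Fin n → Fin n → ℝ)
    (x : Fin n → ℝ) (k i j : Fin n) : ℝ :=
  (1 / 2) * ∑ l, (Matrix.of (g x))⁻¹ k l *
    (pd i (fun y => g y j l) x + pd j (fun y => g y i l) x - pd l (fun y => g y i j) x)

/-- The Levi-Civita covariant derivative `(∇_X Y)^k = X^i ∂ᵢ Y^k + Γ^k_{ij} X^i Y^j`. -/
noncomputable def lcCov {n : ℕ} (g : (Fin n → ℝ) → Fin n → Fin n → ℝ)
    (X Y : VF n) (x : Fin n → ℝ) : Fin n → ℝ :=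
  fun k => fderiv ℝ (fun y => Y y k) x (X x) +
    ∑ i, ∑ j, christoffel g x k i j * X x i * Y x j

/-- The semi-symmetric metric connection `∇̄_X Y = ∇_X Y + π(Y)X − g(X,Y)P`,
where `π(X) = g(X,P)`. -/
noncomputable def ssCov {n : ℕ} (g : (Fin n → ℝ) → Fin n → Fin n → ℝ)
    (P : VF n) (X Y : VF n) (x : Fin n → ℝ) : Fin n → ℝ :=
  fun k => lcCov g X Y x k + gval g x (Y x) (P x) * X x k - gval g x (X x) (Y x) * P x k

/-- The Lie bracket of vector fields. -/
noncomputable def lie {n : ℕ} (X Y : VF n) (x : Fin n → ℝ) : Fin n → ℝ :=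
  fun k => fderiv ℝ (fun y => Y y k) x (X x) - fderiv ℝ (fun y => X y k) x (Y x)

/-- The curvature `R_D(X,Y)Z = D_X D_Y Z − D_Y D_X Z − D_{[X,Y]}Z` of a connection `D`. -/
noncomputable def curv {n : ℕ} (D : VF n → VF n → VF n) (X Y Z : VF n)
    (x : Fin n → ℝ) : Fin n → ℝ :=
  fun k => D X (D Y Z) x k - D Y (D X Z) x k - D (lie X Y) Z x k

/-- The Ricci tensor `Ric_D(Y,Z) = trace (X ↦ R_D(X,Y)Z)` of a connection `D`
(the trace computed in the coordinate frame). -/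
noncomputable def ricci {n : ℕ} (D : VF n → VF n → VF n) (Y Z : VF n)
    (x : Fin n → ℝ) : ℝ :=
  ∑ i, curv D (fun _ => Pi.single i 1) Y Z x i

/-- The symmetrization `Ŝ(Y,Z) = ½(S̄(Y,Z) + S̄(Z,Y))` of the Ricci tensor of the
semi-symmetric metric connection. -/
noncomputable def shat {n : ℕ} (g : (Fin n → ℝ) → Fin n → Fin n → ℝ)
    (P : VF n) (Y Z : VF n) (x : Fin n → ℝ) : ℝ :=
  (ricci (ssCov g P) Y Z x + ricci (ssCov g P) Z Y x) / 2

/-- The covariant derivative `(D_X T)(Y,Z) = X(T(Y,Z)) − T(D_X Y, Z) − T(Y, D_X Z)` of a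
`(0,2)`-tensor `T` along the connection `D`. -/
noncomputable def covT {n : ℕ} (D : VF n → VF n → VF n)
    (T : VF n → VF n → (Fin n → ℝ) → ℝ) (X Y Z : VF n) (x : Fin n → ℝ) : ℝ :=
  fderiv ℝ (T Y Z) x (X x) - T (D X Y) Z x - T Y (D X Z) x

/-- Smoothness of a vector-field/metric-type map on `U`. -/
def SmoothVF {n : ℕ} {E : Type*} [NormedAddCommGroup E] [NormedSpace ℝ E]
    (U : Set (Fin n → ℝ)) (f : (Fin n → ℝ) → E) : Prop :=
  ContDiffOn ℝ (⊤ : ℕ∞) f U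


section helpers
variable {n : ℕ} {U : Set (Fin n → ℝ)}

/-- Smooth scalar function on `U`. -/
def Sm (U : Set (Fin n → ℝ)) (f : (Fin n → ℝ) → ℝ) : Prop := ContDiffOn ℝ (⊤ : ℕ∞) f U

theorem Sm.da (hU : IsOpen U) {f : (Fin n → ℝ) → ℝ} (hf : Sm U f) {x} (hx : x ∈ U) :
    DifferentiableAt ℝ f x :=
  (ContDiffOn.contDiffAt hf (hU.mem_nhds hx)).differentiableAt (by simp)

theorem Sm.add {f h : (Fin n → ℝ) → ℝ} (hf : Sm U f) (hh : Sm U h) :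
    Sm U (fun y => f y + h y) := ContDiffOn.add hf hh

theorem Sm.sub {f h : (Fin n → ℝ) → ℝ} (hf : Sm U f) (hh : Sm U h) :
    Sm U (fun y => f y - h y) := ContDiffOn.sub hf hh

theorem Sm.mul {f h : (Fin n → ℝ) → ℝ} (hf : Sm U f) (hh : Sm U h) :
    Sm U (fun y => f y * h y) := ContDiffOn.mul hf hh

theorem Sm.const (c : ℝ) : Sm U (fun _ => c) := contDiffOn_const

theorem Sm.sum {ι : Type*} {s : Finset ι} {f : ι → (Fin n → ℝ) → ℝ} (hf : ∀ i, Sm U (f i)) :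
    Sm U (fun y => ∑ i ∈ s, f i y) := ContDiffOn.sum fun i _ => hf i

theorem Sm.prod {ι : Type*} {s : Finset ι} {f : ι → (Fin n → ℝ) → ℝ} (hf : ∀ i, Sm U (f i)) :
    Sm U (fun y => ∏ i ∈ s, f i y) := contDiffOn_prod fun i _ => hf i

theorem Sm.pd (hU : IsOpen U) {f : (Fin n → ℝ) → ℝ} (hf : Sm U f) (i : Fin n) :
    Sm U (pd i f) := by
  have h : ContDiffOn ℝ (⊤ : ℕ∞) (fderiv ℝ f) U :=
    ContDiffOn.fderiv_of_isOpen hf hU (by simp)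
  exact h.clm_apply contDiffOn_const

theorem Sm.congr' {f h : (Fin n → ℝ) → ℝ} (hf : Sm U f) (e : ∀ y ∈ U, h y = f y) : Sm U h :=
  ContDiffOn.congr hf e

theorem pd_congr (hU : IsOpen U) {f h : (Fin n → ℝ) → ℝ} (e : ∀ y ∈ U, f y = h y) {x} (hx : x ∈ U)
    (i : Fin n) : pd i f x = pd i h x := by
  unfold pd
  rw [Filter.EventuallyEq.fderiv_eq]
  filter_upwards [hU.mem_nhds hx] with y hy using e y hy

theorem pd_add (hU : IsOpen U) {f h : (Fin n → ℝ) → ℝ} (hf : Sm U f) (hh : Sm U h) {x}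
    (hx : x ∈ U) (i : Fin n) : pd i (fun y => f y + h y) x = pd i f x + pd i h x := by
  unfold pd
  rw [fderiv_fun_add (hf.da hU hx) (hh.da hU hx)]; rfl

theorem pd_sub (hU : IsOpen U) {f h : (Fin n → ℝ) → ℝ} (hf : Sm U f) (hh : Sm U h) {x}
    (hx : x ∈ U) (i : Fin n) : pd i (fun y => f y - h y) x = pd i f x - pd i h x := by
  unfold pd
  rw [fderiv_fun_sub (hf.da hU hx) (hh.da hU hx)]; rfl

theorem pd_mul (hU : IsOpen U) {f h : (Fin n → ℝ) → ℝ} (hf : Sm U f) (hh : Sm U h) {x}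
    (hx : x ∈ U) (i : Fin n) :
    pd i (fun y => f y * h y) x = pd i f x * h x + f x * pd i h x := by
  unfold pd
  rw [fderiv_fun_mul (hf.da hU hx) (hh.da hU hx)]; simp; ring

theorem pd_const (c : ℝ) (x : Fin n → ℝ) (i : Fin n) : pd i (fun _ => c) x = 0 := by
  unfold pd; simp

theorem pd_sum (hU : IsOpen U) {ι : Type*} {s : Finset ι} {f : ι → (Fin n → ℝ) → ℝ}
    (hf : ∀ i, Sm U (f i)) {x} (hx : x ∈ U) (i : Fin n) :
    pd i (fun y => ∑ j ∈ s, f j y) x = ∑ j ∈ s, pd i (f j) x := by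
  unfold pd
  rw [fderiv_fun_sum fun j _ => (hf j).da hU hx]; simp

theorem pd_comm (hU : IsOpen U) {f : (Fin n → ℝ) → ℝ} (hf : Sm U f) {x} (hx : x ∈ U)
    (i j : Fin n) : pd i (pd j f) x = pd j (pd i f) x := by
  have hc : ContDiffAt ℝ (⊤ : ℕ∞) f x := ContDiffOn.contDiffAt hf (hU.mem_nhds hx)
  have hs : IsSymmSndFDerivAt ℝ f x := hc.isSymmSndFDerivAt (by
    simp only [minSmoothness_of_isRCLikeNormedField]
    exact WithTop.coe_le_coe.2 (le_top : (2 : ℕ∞) ≤ ⊤))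
  have hd : DifferentiableAt ℝ (fderiv ℝ f) x :=
    ((ContDiffOn.fderiv_of_isOpen hf hU (m := (⊤ : ℕ∞)) (by simp)).contDiffAt
      (hU.mem_nhds hx)).differentiableAt (by simp)
  have key : ∀ a b : Fin n, pd a (pd b f) x
      = fderiv ℝ (fderiv ℝ f) x (Pi.single a 1) (Pi.single b 1) := by
    intro a b
    change fderiv ℝ (fun y => fderiv ℝ f y (Pi.single b 1)) x (Pi.single a 1) = _
    rw [fderiv_clm_apply hd (differentiableAt_const _)]
    simp
  rw [key, key]; exact hs _ _

theorem fderiv_eq_pd (f : (Fin n → ℝ) → ℝ) (x v : Fin n → ℝ) :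
    fderiv ℝ f x v = ∑ i, v i * pd i f x := by
  unfold pd
  conv_lhs => rw [← Finset.univ_sum_single v, map_sum]
  refine Finset.sum_congr rfl fun i _ => ?_
  rw [← smul_eq_mul, ← map_smul]
  congr 1
  rw [← Pi.single_smul]; simp

/-- connection with symbols `A` -/
noncomputable def connA (A : Fin n → Fin n → Fin n → (Fin n → ℝ) → ℝ) (X Y : VF n) : VF n :=
  fun x k => ∑ j, X x j * pd j (fun y => Y y k) x + ∑ j, ∑ l, A k j l x * X x j * Y x l

theorem Sm.comp {Y : VF n} (hY : SmoothVF U Y) (k : Fin n) : Sm U (fun y => Y y k) :=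
  contDiffOn_pi.1 hY k

theorem curv_connA (hU : IsOpen U) (A : Fin n → Fin n → Fin n → (Fin n → ℝ) → ℝ)
    (hA : ∀ k i j, Sm U (A k i j)) {Y Z : VF n} (hY : SmoothVF U Y) (hZ : SmoothVF U Z)
    {x} (hx : x ∈ U) (a k : Fin n) :
    curv (connA A) (fun _ => Pi.single a 1) Y Z x k =
      ∑ j, ∑ l, (pd a (A k j l) x - pd j (A k a l) x
        + ∑ m, (A k a m x * A m j l x - A k j m x * A m a l x)) * Y x j * Z x l := by
  have sY := fun k => Sm.comp hY k
  have sZ := fun k => Sm.comp hZ k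
  have e1 : ∀ (W : VF n) (y : Fin n → ℝ) (k : Fin n), connA A (fun _ => Pi.single a 1) W y k
      = pd a (fun y => W y k) y + ∑ m, A k a m y * W y m := by
    intro W y k
    unfold connA
    simp [Pi.single_apply]
  have e2 : ∀ j, lie (fun _ => Pi.single a 1) Y x j = pd a (fun y => Y y j) x := by
    intro j
    unfold lie
    rw [fderiv_eq_pd, fderiv_eq_pd]
    simp [Pi.single_apply, pd_const]
  have p1 : pd a (fun y => connA A Y Z y k) x
      = ∑ j, (pd a (fun y => Y y j) x * pd j (fun y => Z y k) x
          + Y x j * pd a (pd j (fun y => Z y k)) x)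
        + ∑ j, ∑ l, ((pd a (A k j l) x * Y x j + A k j l x * pd a (fun y => Y y j) x) * Z x l
          + A k j l x * Y x j * pd a (fun y => Z y l) x) := by
    unfold connA
    have h1 : ∀ j, Sm U (fun y => Y y j * pd j (fun y => Z y k) y) :=
      fun j => (sY j).mul ((sZ k).pd hU j)
    have h2 : ∀ j l, Sm U (fun y => A k j l y * Y y j * Z y l) :=
      fun j l => ((hA k j l).mul (sY j)).mul (sZ l)
    rw [pd_add hU (Sm.sum h1) (Sm.sum fun j => Sm.sum (h2 j)) hx, pd_sum hU h1 hx,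
      pd_sum hU (fun j => Sm.sum (h2 j)) hx]
    congr 1
    · refine Finset.sum_congr rfl fun j _ => ?_
      rw [pd_mul hU (sY j) ((sZ k).pd hU j) hx]
    · refine Finset.sum_congr rfl fun j _ => ?_
      rw [pd_sum hU (h2 j) hx]
      refine Finset.sum_congr rfl fun l _ => ?_
      rw [pd_mul hU ((hA k j l).mul (sY j)) (sZ l) hx, pd_mul hU (hA k j l) (sY j) hx]
  have p2 : ∀ j, pd j (fun y => pd a (fun y => Z y k) y + ∑ m, A k a m y * Z y m) x
      = pd a (pd j (fun y => Z y k)) x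
        + ∑ l, (pd j (A k a l) x * Z x l + A k a l x * pd j (fun y => Z y l) x) := by
    intro j
    have h2 : ∀ m, Sm U (fun y => A k a m y * Z y m) := fun m => (hA k a m).mul (sZ m)
    rw [pd_add hU ((sZ k).pd hU a) (Sm.sum h2) hx, pd_sum hU h2 hx, pd_comm hU (sZ k) hx a j]
    congr 1
    refine Finset.sum_congr rfl fun l _ => ?_
    rw [pd_mul hU (hA k a l) (sZ l) hx]
  have e3 : connA A Y (connA A (fun _ => Pi.single a 1) Z) x k
      = ∑ j, Y x j * (pd a (pd j (fun y => Z y k)) x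
        + ∑ l, (pd j (A k a l) x * Z x l + A k a l x * pd j (fun y => Z y l) x))
       + ∑ j, ∑ m, A k j m x * Y x j * (pd a (fun y => Z y m) x + ∑ l, A m a l x * Z x l) := by
    conv_lhs => unfold connA
    congr 1
    · refine Finset.sum_congr rfl fun j _ => ?_
      rw [← p2 j]
      congr 2
      funext y
      exact e1 Z y k
    · refine Finset.sum_congr rfl fun j _ => Finset.sum_congr rfl fun m _ => ?_
      rw [← e1 Z x m]; rfl
  unfold curv
  rw [e1, p1, e3]
  have e4 : connA A (lie (fun _ => Pi.single a 1) Y) Z x k =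
     ∑ j, pd a (fun y => Y y j) x * pd j (fun y => Z y k) x
      + ∑ j, ∑ l, A k j l x * pd a (fun y => Y y j) x * Z x l := by
    unfold connA; simp only [e2]
  rw [e4]
  unfold connA
  simp only [mul_add, add_mul, sub_mul, Finset.mul_sum, Finset.sum_mul, Finset.sum_add_distrib,
    Finset.sum_sub_distrib]
  have q1 : ∑ m, ∑ j, A k a m x * (Y x j * pd j (fun y => Z y m) x)
     = ∑ j, ∑ l, Y x j * (A k a l x * pd j (fun y => Z y l) x) := by
    rw [Finset.sum_comm]
    exact Finset.sum_congr rfl fun j _ => Finset.sum_congr rfl fun m _ => by ring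
  have q2 : ∑ m, ∑ j, ∑ l, A k a m x * (A m j l x * Y x j * Z x l)
     = ∑ j, ∑ l, ∑ m, A k a m x * A m j l x * Y x j * Z x l := by
    rw [Finset.sum_comm]
    refine Finset.sum_congr rfl fun j _ => ?_
    rw [Finset.sum_comm]
    exact Finset.sum_congr rfl fun l _ => Finset.sum_congr rfl fun m _ => by ring
  have q3 : ∑ j, ∑ m, ∑ l, A k j m x * Y x j * (A m a l x * Z x l)
     = ∑ j, ∑ l, ∑ m, A k j m x * A m a l x * Y x j * Z x l := by
    refine Finset.sum_congr rfl fun j _ => ?_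
    rw [Finset.sum_comm]
    exact Finset.sum_congr rfl fun l _ => Finset.sum_congr rfl fun m _ => by ring
  have q4 : ∑ j, ∑ l, Y x j * (pd j (A k a l) x * Z x l)
     = ∑ j, ∑ l, pd j (A k a l) x * Y x j * Z x l :=
    Finset.sum_congr rfl fun j _ => Finset.sum_congr rfl fun m _ => by ring
  rw [q1, q2, q3, q4]
  ring

theorem inv_sm {g : (Fin n → ℝ) → Fin n → Fin n → ℝ} (hg : ∀ i j, Sm U (fun y => g y i j))
    (hd : ∀ x ∈ U, (Matrix.of (g x)).det ≠ 0) (k l : Fin n) :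
    Sm U (fun y => (Matrix.of (g y))⁻¹ k l) := by
  have hdet : ∀ M : (Fin n → ℝ) → Matrix (Fin n) (Fin n) ℝ, (∀ i j, Sm U (fun y => M y i j)) →
      Sm U (fun y => (M y).det) := by
    intro M hM
    simp only [Matrix.det_apply']
    exact Sm.sum fun s => (Sm.const _).mul (Sm.prod fun i => hM _ _)
  have h1 : Sm U (fun y => ((Matrix.of (g y)).det)⁻¹) :=
    ContDiffOn.inv (hdet _ hg) hd
  have h2 : Sm U (fun y => (Matrix.of (g y)).adjugate k l) := by
    simp only [Matrix.adjugate_apply]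
    refine hdet _ fun i j => ?_
    simp only [Matrix.updateRow_apply]
    split_ifs
    · exact Sm.const _
    · exact hg i j
  refine (h1.mul h2).congr' fun y _ => ?_
  simp [Matrix.inv_def]

/-- the purely algebraic step -/
theorem quad_alg (G : Fin n → Fin n → ℝ) (C : Fin n → Fin n → Fin n → ℝ) (P q : Fin n → ℝ)
    (hG : ∀ i j, G i j = G j i) (hC : ∀ k i j, C k i j = C k j i)
    (hq : ∀ i, q i = ∑ k, G i k * P k) (A : Fin n → Fin n → Fin n → ℝ)
    (hA : ∀ k i j, A k i j = C k i j + q j * (if k = i then 1 else 0) - G i j * P k)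
    (j l : Fin n) :
    ∑ k, ∑ m, (A k k m * A m j l - A k j m * A m k l)
      = ∑ k, ∑ m, (A k k m * A m l j - A k l m * A m k j) := by
  have tr : ∀ m, ∑ k, A k k m = ∑ k, C k k m + (n - 1) * q m := by
    intro m
    simp only [hA, Finset.sum_sub_distrib, Finset.sum_add_distrib]
    simp only [hG _ m, ← hq]
    simp; ring
  have t1 : ∀ j l, ∑ k, ∑ m, A k k m * A m j l
      = ∑ m, (∑ k, C k k m + (n - 1) * q m) * C m j l + (∑ k, C k k j + (n - 1) * q j) * q l
        - (∑ m, (∑ k, C k k m + (n - 1) * q m) * P m) * G j l := by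
    intro j l
    rw [Finset.sum_comm]
    simp only [← Finset.sum_mul, tr]
    simp only [hA, mul_sub, mul_add, Finset.sum_sub_distrib, Finset.sum_add_distrib]
    simp [Finset.sum_mul, ← mul_assoc, mul_right_comm]
  have t2 : ∀ j l, ∑ k, ∑ m, A k j m * A m k l
      = ∑ k, ∑ m, C k j m * C m k l + (∑ k, C k k j) * q l
        - ∑ k, ∑ m, C k j m * G k l * P m + ∑ m, q m * C m j l + q j * q l
        - (∑ m, q m * P m) * G j l - ∑ k, ∑ m, C m k l * G j m * P k
        - (∑ k, P k * q l * G j k) + q j * q l := by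
    intro j l
    have e : q j * q l = ∑ k, ∑ m, (G j m * P m) * (G l k * P k) := by
      rw [hq j, hq l, Finset.sum_mul_sum, Finset.sum_comm]
    have e' : (∑ k, C k k j) * q l = ∑ k, ∑ m, C k j m * (q l * (if m = k then 1 else 0)) := by
      simp [Finset.sum_mul, hC _ j]
    have e3 : ∑ m, q m * C m j l = ∑ k, ∑ m, (q m * if k = j then 1 else 0) * C m k l := by
      simp
    have e4 : (∑ m, q m * P m) * G j l
        = ∑ k, ∑ m, (q m * if k = j then 1 else 0) * (G k l * P m) := by
      simp [Finset.sum_mul]; exact Finset.sum_congr rfl fun _ _ => by ring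
    have e5 : (∑ k, P k * q l * G j k)
        = ∑ k, ∑ m, G j m * P k * (q l * if m = k then 1 else 0) := by
      simp; exact Finset.sum_congr rfl fun _ _ => by ring
    have e6 : q j * q l = ∑ k, ∑ m, (q m * if k = j then 1 else 0)
        * (q l * if m = k then 1 else 0) := by
      simp
    conv_rhs => rw [e', e3, e4, e5]
    conv_rhs => enter [1,1,1,1,2]; rw [e6]
    conv_rhs => enter [2]; rw [e]
    simp only [← Finset.sum_sub_distrib, ← Finset.sum_add_distrib]
    refine Finset.sum_congr rfl fun k _ => Finset.sum_congr rfl fun m _ => ?_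
    rw [hA, hA, hG k l]
    ring
  simp only [Finset.sum_sub_distrib]
  rw [t1, t1, t2, t2]
  have s1 : ∑ k, ∑ m, C k j m * C m k l = ∑ k, ∑ m, C k l m * C m k j := by
    rw [Finset.sum_comm]
    exact Finset.sum_congr rfl fun k _ => Finset.sum_congr rfl fun m _ => by
      rw [hC m j k, hC k m l]; ring
  have s2 : ∀ j l, ∑ k, ∑ m, C k j m * G k l * P m = ∑ k, ∑ m, C m k j * G l m * P k := by
    intro j l
    rw [Finset.sum_comm]
    exact Finset.sum_congr rfl fun k _ => Finset.sum_congr rfl fun m _ => by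
      rw [hC m j k, hG l m]
  have s3 : ∀ j l, ∑ k, P k * q l * G j k = q j * q l := by
    intro j l
    rw [hq j, Finset.sum_mul]
    exact Finset.sum_congr rfl fun _ _ => by ring
  rw [s1, s2 j l, s2 l j, s3, s3, hG l j]
  simp only [hC _ l j]
  ring
end helpers

section helpers2
variable {n : ℕ} {U : Set (Fin n → ℝ)}

theorem pd_inv (hU : IsOpen U) {g : (Fin n → ℝ) → Fin n → Fin n → ℝ}
    (hg : ∀ i j, Sm U (fun y => g y i j))
    (hd : ∀ x ∈ U, (Matrix.of (g x)).det ≠ 0) {x} (hx : x ∈ U) (a k l : Fin n) :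
    pd a (fun y => (Matrix.of (g y))⁻¹ k l) x
      = - ∑ p, ∑ q, (Matrix.of (g x))⁻¹ k p * pd a (fun y => g y p q) x
          * (Matrix.of (g x))⁻¹ q l := by
  have hh := inv_sm hg hd
  have h1 : ∀ y ∈ U, (Matrix.of (g y))⁻¹ * Matrix.of (g y) = 1 := fun y hy =>
    Matrix.nonsing_inv_mul _ (isUnit_iff_ne_zero.2 (hd y hy))
  have h2 : Matrix.of (g x) * (Matrix.of (g x))⁻¹ = 1 :=
    Matrix.mul_nonsing_inv _ (isUnit_iff_ne_zero.2 (hd x hx))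
  have key : ∀ m, ∑ p, (pd a (fun y => (Matrix.of (g y))⁻¹ k p) x * g x p m
      + (Matrix.of (g x))⁻¹ k p * pd a (fun y => g y p m) x) = 0 := by
    intro m
    have := pd_congr (f := fun y => ∑ p, (Matrix.of (g y))⁻¹ k p * g y p m)
      (h := fun _ => (1 : Matrix (Fin n) (Fin n) ℝ) k m) hU (fun y hy => by
        rw [← h1 y hy]; simp [Matrix.mul_apply]) hx a
    rw [pd_const, pd_sum hU (fun p => (hh k p).mul (hg p m)) hx] at this
    rw [← this]
    exact Finset.sum_congr rfl fun p _ => (pd_mul hU (hh k p) (hg p m) hx a).symm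
  have e : pd a (fun y => (Matrix.of (g y))⁻¹ k l) x
      = ∑ m, (∑ p, pd a (fun y => (Matrix.of (g y))⁻¹ k p) x * g x p m)
          * (Matrix.of (g x))⁻¹ m l := by
    simp only [Finset.sum_mul]
    rw [Finset.sum_comm]
    have : ∀ p, ∑ m, g x p m * (Matrix.of (g x))⁻¹ m l = if p = l then 1 else 0 := by
      intro p
      have := congrFun (congrFun h2 p) l
      rw [Matrix.mul_apply, Matrix.one_apply] at this
      exact this
    simp only [mul_assoc, ← Finset.mul_sum, this]
    simp
  rw [e, Finset.sum_comm, ← Finset.sum_neg_distrib]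
  refine Finset.sum_congr rfl fun m _ => ?_
  have := key m
  rw [Finset.sum_add_distrib] at this
  rw [eq_neg_of_add_eq_zero_left this, ← Finset.sum_mul]
  ring

theorem ssCov_eq (g : (Fin n → ℝ) → Fin n → Fin n → ℝ) (P : VF n)
    (A : Fin n → Fin n → Fin n → (Fin n → ℝ) → ℝ)
    (hA : ∀ k i j y, A k i j y = christoffel g y k i j
      + (∑ m, g y j m * P y m) * (if k = i then 1 else 0) - g y i j * P y k) :
    ssCov g P = connA A := by
  funext X Y x k
  unfold ssCov lcCov connA gval
  rw [fderiv_eq_pd]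
  simp only [hA, add_mul, sub_mul, Finset.sum_add_distrib, Finset.sum_sub_distrib]
  have h1 : (∑ i, ∑ j, g x i j * Y x i * P x j) * X x k
      = ∑ i, ∑ j, (∑ m, g x j m * P x m) * (if k = i then 1 else 0) * X x i * Y x j := by
    simp only [mul_ite, ite_mul, mul_one, mul_zero, zero_mul, Finset.sum_mul]
    rw [Finset.sum_comm (s := Finset.univ) (f := fun i j => if k = i then _ else _)]
    simp only [Finset.sum_ite_eq, Finset.mem_univ, if_true]
    exact Finset.sum_congr rfl fun i _ => Finset.sum_congr rfl fun j _ => by ring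
  have h2 : (∑ i, ∑ j, g x i j * X x i * Y x j) * P x k
      = ∑ i, ∑ j, g x i j * P x k * X x i * Y x j := by
    simp only [Finset.sum_mul]
    exact Finset.sum_congr rfl fun i _ => Finset.sum_congr rfl fun j _ => by ring
  rw [h1, h2]
  ring
end helpers2

/-- On an open `U ⊆ ℝⁿ` (`n ≥ 3`) with Riemannian metric `g`, Levi-Civita
connection `∇`, vector field `P`, `π(X) = g(X,P)`, semi-symmetric metric connection `∇̄`,
`S̄ = Ric_∇̄`: if the 1-form `π` is closed, i.e. `g(∇_Y P, Z) = g(∇_Z P, Y)` for all vector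
fields `Y, Z`, then the Ricci tensor of the semi-symmetric metric connection is symmetric:
`S̄(Y,Z) = S̄(Z,Y)` for all vector fields `Y, Z`. -/
theorem statement18 (n : ℕ) (hn : 3 ≤ n)
    (U : Set (Fin n → ℝ)) (hU : IsOpen U)
    (g : (Fin n → ℝ) → Fin n → Fin n → ℝ) (hg : SmoothVF U g)
    (hgpos : ∀ x ∈ U, (Matrix.of (g x)).PosDef)
    (P : VF n) (hP : SmoothVF U P)
    (hclosed : ∀ Y Z : VF n, SmoothVF U Y → SmoothVF U Z → ∀ x ∈ U,
      gval g x (lcCov g Y P x) (Z x) = gval g x (lcCov g Z P x) (Y x)) :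
    ∀ Y Z : VF n, SmoothVF U Y → SmoothVF U Z → ∀ x ∈ U,
      ricci (ssCov g P) Y Z x = ricci (ssCov g P) Z Y x := by
  intro Y Z hY hZ x hx
  have sg : ∀ i j, Sm U (fun y => g y i j) := fun i j =>
    contDiffOn_pi.1 (contDiffOn_pi.1 hg i) j
  have sP : ∀ k, Sm U (fun y => P y k) := fun k => Sm.comp hP k
  have hsym : ∀ y ∈ U, ∀ i j, g y i j = g y j i := by
    intro y hy i j
    have := (hgpos y hy).isHermitian.apply j i
    simpa using this
  have hd : ∀ y ∈ U, (Matrix.of (g y)).det ≠ 0 := fun y hy => (hgpos y hy).det_pos.ne'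
  have sh := inv_sm sg hd
  have hinv : ∀ y ∈ U, ∀ i j, (Matrix.of (g y))⁻¹ i j = (Matrix.of (g y))⁻¹ j i := by
    intro y hy i j
    have := (hgpos y hy).isHermitian.inv.apply j i
    simpa using this
  have dsym : ∀ a i j, ∀ y ∈ U, pd a (fun y => g y i j) y = pd a (fun y => g y j i) y :=
    fun a i j y hy => pd_congr hU (fun y hy => hsym y hy i j) hy a
  have sC : ∀ k i j, Sm U (fun y => christoffel g y k i j) := by
    intro k i j
    unfold christoffel
    exact (Sm.const _).mul (Sm.sum fun l => (sh k l).mul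
      ((((sg j l).pd hU i).add ((sg i l).pd hU j)).sub ((sg i j).pd hU l)))
  have Csym : ∀ y ∈ U, ∀ k i j, christoffel g y k i j = christoffel g y k j i := by
    intro y hy k i j
    unfold christoffel
    congr 1
    refine Finset.sum_congr rfl fun l _ => ?_
    rw [dsym l i j y hy]; ring
  have sq : ∀ j, Sm U (fun y => ∑ m, g y j m * P y m) := fun j =>
    Sm.sum fun m => (sg j m).mul (sP m)
  obtain ⟨A, hA⟩ : ∃ A : Fin n → Fin n → Fin n → (Fin n → ℝ) → ℝ,
    ∀ k i j, A k i j = fun y => christoffel g y k i j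
      + (∑ m, g y j m * P y m) * (if k = i then 1 else 0) - g y i j * P y k :=
    ⟨_, fun _ _ _ => rfl⟩
  have sA : ∀ k i j, Sm U (A k i j) := by
    intro k i j
    rw [hA]
    exact ((sC k i j).add ((sq j).mul (Sm.const _))).sub ((sg i j).mul (sP k))
  rw [ssCov_eq g P A (fun k i j y => by rw [hA])]
  -- closedness in coordinates
  have hcl : ∀ j l, pd j (fun y => ∑ m, g y l m * P y m) x
      = pd l (fun y => ∑ m, g y j m * P y m) x := by
    intro j l
    have h0 := hclosed (fun _ => Pi.single j 1) (fun _ => Pi.single l 1) contDiffOn_const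
      contDiffOn_const x hx
    have gv : ∀ (v : Fin n → ℝ) (b : Fin n), gval g x v (Pi.single b 1) = ∑ k, g x b k * v k := by
      intro v b
      unfold gval
      refine Finset.sum_congr rfl fun k _ => ?_
      simp [Pi.single_apply, hsym x hx k b]
    have lc : ∀ (b k : Fin n), lcCov g (fun _ => Pi.single b 1) P x k
        = pd b (fun y => P y k) x + ∑ m, christoffel g x k b m * P x m := by
      intro b k
      unfold lcCov
      simp [Pi.single_apply, pd]
    have low : ∀ b i j, ∑ k, g x b k * christoffel g x k i j = 1 / 2 *
        (pd i (fun y => g y j b) x + pd j (fun y => g y i b) x - pd b (fun y => g y i j) x) := by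
      intro b i j
      unfold christoffel
      have h2 : Matrix.of (g x) * (Matrix.of (g x))⁻¹ = 1 :=
        Matrix.mul_nonsing_inv _ (isUnit_iff_ne_zero.2 (hd x hx))
      have h3 : ∀ l, ∑ m, g x b m * (Matrix.of (g x))⁻¹ m l = if b = l then 1 else 0 := by
        intro l
        have := congrFun (congrFun h2 b) l
        rw [Matrix.mul_apply, Matrix.one_apply] at this
        exact this
      simp only [mul_left_comm (g x b _) (1 / 2), ← Finset.mul_sum]
      congr 1
      simp only [Finset.mul_sum, ← mul_assoc]
      rw [Finset.sum_comm]
      simp only [← Finset.sum_mul, h3]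
      simp
    have ex : ∀ b c, gval g x (lcCov g (fun _ => Pi.single b 1) P x) (Pi.single c 1)
        = ∑ k, g x c k * pd b (fun y => P y k) x + ∑ m, (1 / 2 *
        (pd b (fun y => g y m c) x + pd m (fun y => g y b c) x
          - pd c (fun y => g y b m) x)) * P x m := by
      intro b c
      rw [gv]
      simp only [lc, mul_add, Finset.sum_add_distrib, ← low, Finset.mul_sum, Finset.sum_mul]
      congr 1
      rw [Finset.sum_comm]
      exact Finset.sum_congr rfl fun i _ => Finset.sum_congr rfl fun j _ => by ring
    have dq : ∀ b c, pd b (fun y => ∑ m, g y c m * P y m) x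
        = ∑ k, g x c k * pd b (fun y => P y k) x
          + ∑ m, pd b (fun y => g y c m) x * P x m := by
      intro b c
      rw [pd_sum hU (fun m => (sg c m).mul (sP m)) hx, ← Finset.sum_add_distrib]
      refine Finset.sum_congr rfl fun m _ => ?_
      rw [pd_mul hU (sg c m) (sP m) hx]; ring
    change gval g x (lcCov g (fun _ => Pi.single j 1) P x) (Pi.single l 1)
      = gval g x (lcCov g (fun _ => Pi.single l 1) P x) (Pi.single j 1) at h0
    rw [ex, ex] at h0
    rw [dq, dq]
    have h5 : ∑ m, pd j (fun y => g y l m) x * P x m - ∑ m, pd l (fun y => g y j m) x * P x m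
       = ∑ m, (1 / 2 * (pd j (fun y => g y m l) x + pd m (fun y => g y j l) x
          - pd l (fun y => g y j m) x)) * P x m
         - ∑ m, (1 / 2 * (pd l (fun y => g y m j) x + pd m (fun y => g y l j) x
          - pd j (fun y => g y l m) x)) * P x m := by
      rw [← Finset.sum_sub_distrib, ← Finset.sum_sub_distrib]
      refine Finset.sum_congr rfl fun m _ => ?_
      rw [dsym j m l x hx, dsym l m j x hx, dsym m l j x hx]
      ring
    linarith
  -- the trace of the Christoffel symbols
  have trC : ∀ l, ∀ y ∈ U, ∑ k, christoffel g y k k l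
      = ∑ k, ∑ p, 1 / 2 * ((Matrix.of (g y))⁻¹ k p * pd l (fun y => g y k p) y) := by
    intro l y hy
    unfold christoffel
    simp only [Finset.mul_sum, mul_sub, mul_add, Finset.sum_sub_distrib, Finset.sum_add_distrib]
    have : ∑ k, ∑ p, 1 / 2 * ((Matrix.of (g y))⁻¹ k p * pd p (fun y => g y k l) y)
      = ∑ k, ∑ p, 1 / 2 * ((Matrix.of (g y))⁻¹ k p * pd k (fun y => g y l p) y) := by
      rw [Finset.sum_comm]
      refine Finset.sum_congr rfl fun k _ => Finset.sum_congr rfl fun p _ => ?_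
      rw [hinv y hy p k, dsym k p l y hy]
    rw [this]; ring
  have hgam : ∀ j l, pd j (fun y => ∑ k, christoffel g y k k l) x
      = pd l (fun y => ∑ k, christoffel g y k k j) x := by
    intro j l
    have ex : ∀ j l, pd j (fun y => ∑ k, christoffel g y k k l) x
      = ∑ k, ∑ p, 1 / 2 * (pd j (fun y => (Matrix.of (g y))⁻¹ k p) x * pd l (fun y => g y k p) x)
        + ∑ k, ∑ p, 1 / 2 * ((Matrix.of (g x))⁻¹ k p * pd j (pd l (fun y => g y k p)) x) := by
      intro j l
      have s1 : ∀ k p, Sm U (fun y => (Matrix.of (g y))⁻¹ k p * pd l (fun y => g y k p) y) :=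
        fun k p => (sh k p).mul ((sg k p).pd hU l)
      rw [pd_congr hU (trC l) hx,
        pd_sum hU (fun k => Sm.sum fun p => (Sm.const (1 / 2)).mul (s1 k p)) hx,
        ← Finset.sum_add_distrib]
      refine Finset.sum_congr rfl fun k _ => ?_
      rw [pd_sum hU (fun p => (Sm.const (1 / 2)).mul (s1 k p)) hx, ← Finset.sum_add_distrib]
      refine Finset.sum_congr rfl fun p _ => ?_
      rw [pd_mul hU (Sm.const (1 / 2)) (s1 k p) hx, pd_const,
        pd_mul hU (sh k p) ((sg k p).pd hU l) hx]
      ring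
    rw [ex, ex]
    congr 1
    · simp only [pd_inv hU sg hd hx, ← Finset.mul_sum]
      congr 1
      simp only [neg_mul, Finset.sum_neg_distrib, Finset.sum_mul]
      congr 1
      -- sum over k p a b of h k a * dj g a b * h b p * dl g k p
      have r : ∀ F : Fin n → Fin n → Fin n → Fin n → ℝ,
          ∑ k, ∑ p, ∑ a, ∑ b, F k p a b = ∑ k, ∑ p, ∑ a, ∑ b, F a b k p := by
        intro F
        have := Finset.sum_comm (s := (Finset.univ : Finset (Fin n × Fin n)))
          (t := (Finset.univ : Finset (Fin n × Fin n))) (f := fun u v => F u.1 u.2 v.1 v.2)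
        simpa only [Fintype.sum_prod_type] using this
      rw [r]
      refine Finset.sum_congr rfl fun k _ => Finset.sum_congr rfl fun p _ =>
        Finset.sum_congr rfl fun a _ => Finset.sum_congr rfl fun b _ => ?_
      rw [hinv x hx a k, hinv x hx p b]
      ring
    · refine Finset.sum_congr rfl fun k _ => Finset.sum_congr rfl fun p _ => ?_
      rw [pd_comm hU (sg k p) hx]
  -- the two derivative terms
  have d1 : ∀ j l, ∑ k, pd k (A k j l) x = ∑ k, pd k (A k l j) x := by
    have ex : ∀ j l, ∑ k, pd k (A k j l) x = ∑ k, pd k (fun y => christoffel g y k j l) x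
        + pd j (fun y => ∑ m, g y l m * P y m) x - ∑ k, pd k (fun y => g y j l * P y k) x := by
      intro j l
      have : ∀ k, pd k (A k j l) x = pd k (fun y => christoffel g y k j l) x
        + pd k (fun y => ∑ m, g y l m * P y m) x * (if k = j then 1 else 0)
        - pd k (fun y => g y j l * P y k) x := by
        intro k
        rw [hA, pd_sub hU ((sC k j l).add ((sq l).mul (Sm.const _))) ((sg j l).mul (sP k)) hx,
          pd_add hU (sC k j l) ((sq l).mul (Sm.const _)) hx, pd_mul hU (sq l) (Sm.const _) hx,
          pd_const]
        ring
      simp only [this, Finset.sum_add_distrib, Finset.sum_sub_distrib]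
      simp
    intro j l
    rw [ex, ex, hcl j l]
    congr 1
    · congr 1
      exact Finset.sum_congr rfl fun k _ => pd_congr hU (fun y hy => Csym y hy k j l) hx k
    · exact Finset.sum_congr rfl fun k _ =>
        pd_congr hU (fun y hy => by rw [hsym y hy j l]) hx k
  have d2 : ∀ j l, ∑ k, pd j (A k k l) x = ∑ k, pd l (A k k j) x := by
    have ex : ∀ j l, ∑ k, pd j (A k k l) x = pd j (fun y => ∑ k, christoffel g y k k l) x
        + (n - 1) * pd j (fun y => ∑ m, g y l m * P y m) x := by
      intro j l
      rw [← pd_sum hU (fun k => sA k k l) hx, pd_congr hU (h := fun y =>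
        (∑ k, christoffel g y k k l) + ((n : ℝ) - 1) * (∑ m, g y l m * P y m)) _ hx,
        pd_add hU (Sm.sum fun k => sC k k l) ((Sm.const _).mul (sq l)) hx,
        pd_mul hU (Sm.const _) (sq l) hx, pd_const]
      · ring
      · intro y hy
        simp only [hA, Finset.sum_sub_distrib, Finset.sum_add_distrib, hsym y hy _ l]
        simp; ring
    intro j l
    rw [ex, ex, hgam j l, hcl j l]
  have d3 := quad_alg (fun i j => g x i j) (fun k i j => christoffel g x k i j) (P x)
    (fun j => ∑ m, g x j m * P x m) (hsym x hx) (Csym x hx) (fun _ => rfl)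
    (fun k i j => A k i j x) (fun k i j => by rw [hA])
  have ric : ∀ Y Z : VF n, SmoothVF U Y → SmoothVF U Z → ricci (connA A) Y Z x
      = ∑ j, ∑ l, (∑ k, pd k (A k j l) x - ∑ k, pd j (A k k l) x
        + ∑ k, ∑ m, (A k k m x * A m j l x - A k j m x * A m k l x)) * Y x j * Z x l := by
    intro Y Z hY hZ
    unfold ricci
    simp only [curv_connA hU A sA hY hZ hx]
    rw [Finset.sum_comm]
    refine Finset.sum_congr rfl fun j _ => ?_
    rw [Finset.sum_comm]
    refine Finset.sum_congr rfl fun l _ => ?_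
    rw [← Finset.sum_mul, ← Finset.sum_mul, Finset.sum_add_distrib, Finset.sum_sub_distrib]
  rw [ric Y Z hY hZ, ric Z Y hZ hY, Finset.sum_comm]
  refine Finset.sum_congr rfl fun j _ => Finset.sum_congr rfl fun l _ => ?_
  rw [d1 l j, d2 l j, d3 l j]
  ring
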